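/- Let H be a separable infinite-dimensional real Hilbert space, endow O₊(B) with the topology of pointwise convergence, fix p₀ ∈ ℋ(H), and let O = { k ∈ O₊(B) : k·p₀ = p₀ } be the stabiliser of p₀. Let g ∈ O₊(B) with g ∉ O, and let U ⊆ O be a neighbourhood of the identity in O (for the subspace topology). Then the set O·g⁻¹·U·g·O = { k₁ g⁻¹ u g k₂ : k₁, k₂ ∈ O, u ∈ U } is a neighbourhood of O in O₊(B), i.e. it contains an open subset of O₊(B) containing O. -/

import Mathlib

open scoped RealInnerProductSpace

variable (H : Type*) [NormedAddCommGroup H] [InnerProductSpace ℝ H]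

/-- The Minkowski bilinear form on `ℝ × H`. -/
noncomputable def minkB (v w : ℝ × H) : ℝ := v.1 * w.1 - ⟪v.2, w.2⟫

/-- The hyperboloid model of hyperbolic space inside `ℝ × H`. -/
noncomputable def Hyp : Set (ℝ × H) := {v | minkB H v v = 1 ∧ 0 < v.1}

/-- Inverse hyperbolic cosine. -/
noncomputable def arcosh (x : ℝ) : ℝ := Real.log (x + Real.sqrt (x ^ 2 - 1))

/-- The hyperbolic distance on the hyperboloid. -/
noncomputable def hypDist (x y : ℝ × H) : ℝ := arcosh (minkB H x y)

/-- A subset of the hyperboloid is hyperbolically total if its closed linear span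
is all of `ℝ × H`. -/
def HypTotal (S : Set (ℝ × H)) : Prop :=
  (Submodule.span ℝ S).topologicalClosure = ⊤

/-- A kernel of hyperbolic type. -/
def IsHypKernel {X : Type*} (β : X → X → ℝ) : Prop :=
  (∀ x y, β x y = β y x) ∧ (∀ x y, 0 ≤ β x y) ∧ (∀ x, β x x = 1) ∧
    ∀ (n : ℕ) (x₀ : X) (x : Fin n → X) (c : Fin n → ℝ),
      ∑ i, ∑ j, c i * c j * β (x i) (x j) ≤ (∑ k, c k * β (x k) x₀) ^ 2

/-- A kernel of conditionally negative type. -/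
def IsCNDKernel {X : Type*} (ψ : X → X → ℝ) : Prop :=
  (∀ x y, ψ x y = ψ y x) ∧ (∀ x, ψ x x = 0) ∧
    ∀ (n : ℕ) (x : Fin n → X) (c : Fin n → ℝ), (∑ i, c i = 0) →
      ∑ i, ∑ j, c i * c j * ψ (x i) (x j) ≤ 0

/-- The group `O₊(B)` of continuous linear automorphisms of `ℝ × H` preserving the
Minkowski form and the upper hyperboloid sheet. -/
noncomputable def Oplus : Subgroup ((ℝ × H) ≃L[ℝ] (ℝ × H)) where
  carrier := {g | (∀ v w, minkB H (g v) (g w) = minkB H v w) ∧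
    ∀ v, v ∈ Hyp H ↔ g v ∈ Hyp H}
  one_mem' := ⟨fun _ _ => rfl, fun _ => Iff.rfl⟩
  mul_mem' := by
    rintro a b ⟨ha1, ha2⟩ ⟨hb1, hb2⟩
    refine ⟨fun v w => ?_, fun v => ?_⟩
    · show minkB H (a (b v)) (a (b w)) = _
      rw [ha1, hb1]
    · show v ∈ Hyp H ↔ a (b v) ∈ Hyp H
      rw [← ha2, ← hb2]
  inv_mem' := by
    rintro a ⟨ha1, ha2⟩
    refine ⟨fun v w => ?_, fun v => ?_⟩
    · show minkB H (a.symm v) (a.symm w) = minkB H v w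
      conv_rhs => rw [← a.apply_symm_apply v, ← a.apply_symm_apply w, ha1]
    · show v ∈ Hyp H ↔ a.symm v ∈ Hyp H
      conv_lhs => rw [← a.apply_symm_apply v, ← ha2]


/-- The topology of pointwise convergence on `O₊(B)`: the coarsest topology making
`g ↦ g x` continuous for every `x ∈ ℝ × H`. -/
noncomputable def ptTop (H : Type*) [NormedAddCommGroup H] [InnerProductSpace ℝ H] :
    TopologicalSpace (Oplus H) :=
  TopologicalSpace.induced (fun g : Oplus H => fun v : ℝ × H => g.1 v)
    Pi.topologicalSpace

section Reflections

variable {H : Type*} [NormedAddCommGroup H] [InnerProductSpace ℝ H]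

theorem minkB_comm (v w : ℝ × H) : minkB H v w = minkB H w v := by
  simp only [minkB, real_inner_comm, mul_comm]

theorem minkB_add_left (u v w : ℝ × H) : minkB H (u + v) w = minkB H u w + minkB H v w := by
  simp only [minkB, Prod.fst_add, Prod.snd_add, inner_add_left]
  ring

theorem minkB_sub_left (u v w : ℝ × H) : minkB H (u - v) w = minkB H u w - minkB H v w := by
  simp only [minkB, Prod.fst_sub, Prod.snd_sub, inner_sub_left]
  ring

theorem minkB_smul_left (c : ℝ) (v w : ℝ × H) : minkB H (c • v) w = c * minkB H v w := by
  simp only [minkB, Prod.smul_fst, Prod.smul_snd, real_inner_smul_left, smul_eq_mul]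
  ring

theorem minkB_add_right (u v w : ℝ × H) : minkB H u (v + w) = minkB H u v + minkB H u w := by
  simp only [minkB_comm u, minkB_add_left]

theorem minkB_sub_right (u v w : ℝ × H) : minkB H u (v - w) = minkB H u v - minkB H u w := by
  simp only [minkB_comm u, minkB_sub_left]

theorem minkB_smul_right (c : ℝ) (v w : ℝ × H) : minkB H v (c • w) = c * minkB H v w := by
  simp only [minkB_comm v, minkB_smul_left]

theorem Continuous.minkB {X : Type*} [TopologicalSpace X] {f g : X → ℝ × H}
    (hf : Continuous f) (hg : Continuous g) : Continuous fun x => minkB H (f x) (g x) := by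
  unfold _root_.minkB
  fun_prop

/-- A nonzero vector orthogonal to a point of the hyperboloid is spacelike. -/
theorem minkB_self_neg {p v : ℝ × H} (hp : p ∈ Hyp H) (hvp : minkB H v p = 0) (hv : v ≠ 0) :
    minkB H v v < 0 := by
  obtain ⟨hp1, hp0⟩ := hp
  have hcs := real_inner_mul_inner_self_le v.2 p.2
  simp only [minkB] at *
  by_cases h2 : v.2 = 0
  · have h1 : v.1 = 0 := by
      simpa [h2, hp0.ne'] using hvp
    exact absurd (Prod.ext h1 h2) hv
  · have hpos : 0 < ⟪v.2, v.2⟫ := real_inner_self_pos.2 h2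
    have e : ⟪v.2, p.2⟫ = v.1 * p.1 := by linarith
    have e' : ⟪p.2, p.2⟫ = p.1 * p.1 - 1 := by linarith
    rw [e, e'] at hcs
    have : 0 < p.1 * p.1 := by positivity
    by_contra! hcon
    nlinarith [mul_le_mul_of_nonneg_right (sub_nonneg.1 hcon) this.le]

/-- A unit timelike vector lies on the upper sheet exactly when it pairs positively with some
point of the upper sheet. -/
theorem mem_Hyp_iff {p w : ℝ × H} (hp : p ∈ Hyp H) (hw : minkB H w w = 1) :
    w ∈ Hyp H ↔ 0 < minkB H w p := by
  obtain ⟨hp1, hp0⟩ := hp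
  have hcs := real_inner_mul_inner_self_le w.2 p.2
  have hww := hw
  simp only [Hyp, Set.mem_ofPred_eq, hw, true_and]
  simp only [minkB] at *
  have e : ⟪w.2, w.2⟫ = w.1 * w.1 - 1 := by linarith
  have e' : ⟪p.2, p.2⟫ = p.1 * p.1 - 1 := by linarith
  have h0 := real_inner_self_nonneg (x := w.2)
  have h0' := real_inner_self_nonneg (x := p.2)
  rw [e] at h0
  rw [e'] at h0'
  rw [e, e'] at hcs
  have hlt : ⟪w.2, p.2⟫ ^ 2 < (w.1 * p.1) ^ 2 := by nlinarith
  have habs := sq_lt_sq.1 hlt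
  constructor
  · intro h
    rw [abs_of_pos (mul_pos h hp0)] at habs
    linarith [le_abs_self ⟪w.2, p.2⟫]
  · intro h
    by_contra! hcon
    rw [abs_of_nonpos (mul_nonpos_of_nonpos_of_nonneg hcon hp0.le)] at habs
    linarith [neg_abs_le ⟪w.2, p.2⟫]

theorem one_le_minkB {p x : ℝ × H} (hp : p ∈ Hyp H) (hx : x ∈ Hyp H) : 1 ≤ minkB H x p := by
  have hpos := (mem_Hyp_iff hp hx.1).1 hx
  have horth : minkB H (x - minkB H x p • p) p = 0 := by
    rw [minkB_sub_left, minkB_smul_left, hp.1]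
    ring
  have hle : minkB H (x - minkB H x p • p) (x - minkB H x p • p) ≤ 0 := by
    by_cases h : x - minkB H x p • p = 0
    · rw [h]
      simp [minkB]
    · exact (minkB_self_neg hp horth h).le
  simp only [minkB_sub_left, minkB_smul_left, minkB_sub_right, minkB_smul_right, hp.1, hx.1,
    minkB_comm p x] at hle
  nlinarith

/-- The Minkowski reflection in the hyperplane orthogonal to `v`. -/
noncomputable def minkRefl (v w : ℝ × H) : ℝ × H :=
  w - (2 * minkB H w v / minkB H v v) • v

theorem minkRefl_minkRefl {v : ℝ × H} (hv : minkB H v v ≠ 0) (w : ℝ × H) :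
    minkRefl v (minkRefl v w) = w := by
  simp only [minkRefl, minkB_sub_left, minkB_smul_left, div_mul_cancel₀ _ hv]
  rw [sub_sub, ← add_smul]
  have : 2 * minkB H w v / minkB H v v +
      2 * (minkB H w v - 2 * minkB H w v) / minkB H v v = 0 := by
    ring
  rw [this, zero_smul, sub_zero]

theorem minkB_minkRefl {v : ℝ × H} (hv : minkB H v v ≠ 0) (w z : ℝ × H) :
    minkB H (minkRefl v w) (minkRefl v z) = minkB H w z := by
  simp only [minkRefl, minkB_sub_left, minkB_smul_left, minkB_sub_right, minkB_smul_right,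
    minkB_comm v z]
  field_simp
  ring

theorem minkRefl_of_orthogonal {v p : ℝ × H} (h : minkB H v p = 0) : minkRefl v p = p := by
  simp [minkRefl, minkB_comm p v, h]

theorem continuous_minkRefl (v : ℝ × H) : Continuous (minkRefl v) := by
  unfold minkRefl
  have := continuous_id.minkB (continuous_const (y := v))
  fun_prop

/-- The reflection in a nonisotropic vector, as a continuous linear equivalence. -/
noncomputable def minkReflEquiv (v : ℝ × H) (hv : minkB H v v ≠ 0) :
    (ℝ × H) ≃L[ℝ] (ℝ × H) where
  toFun := minkRefl v
  map_add' x y := by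
    simp only [minkRefl, minkB_add_left, mul_add, add_div, add_smul]
    abel
  map_smul' c x := by
    simp only [minkRefl, minkB_smul_left, RingHom.id_apply, smul_sub, smul_smul]
    congr 2
    ring
  invFun := minkRefl v
  left_inv := minkRefl_minkRefl hv
  right_inv := minkRefl_minkRefl hv
  continuous_toFun := continuous_minkRefl v
  continuous_invFun := continuous_minkRefl v

theorem exists_Oplus_eq_minkRefl {p v : ℝ × H} (hp : p ∈ Hyp H) (hvp : minkB H v p = 0)
    (hv : minkB H v v ≠ 0) : ∃ k : Oplus H, ∀ w, k.1 w = minkRefl v w := by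
  refine ⟨⟨minkReflEquiv v hv, minkB_minkRefl hv, fun w => ?_⟩, fun w => rfl⟩
  change w ∈ Hyp H ↔ minkRefl v w ∈ Hyp H
  have hB : minkB H (minkRefl v w) p = minkB H w p := by
    rw [← minkB_minkRefl hv w p, minkRefl_of_orthogonal hvp]
  have hS := minkB_minkRefl hv w w
  constructor
  · intro h
    rw [mem_Hyp_iff hp (hS.trans h.1), hB]
    exact (mem_Hyp_iff hp h.1).1 h
  · intro h
    rw [mem_Hyp_iff hp (hS.symm.trans h.1), ← hB]
    exact (mem_Hyp_iff hp h.1).1 h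

/-- The stabiliser of `p` acts transitively on each sphere centred at `p`. -/
theorem exists_stabiliser_apply_eq {p x y : ℝ × H} (hp : p ∈ Hyp H) (hx : x ∈ Hyp H)
    (hy : y ∈ Hyp H) (h : minkB H x p = minkB H y p) :
    ∃ k : Oplus H, k.1 p = p ∧ k.1 x = y := by
  by_cases hxy : x = y
  · exact ⟨1, rfl, hxy⟩
  have hvp : minkB H (x - y) p = 0 := by rw [minkB_sub_left, h, sub_self]
  have hv := (minkB_self_neg hp hvp (sub_ne_zero.2 hxy)).ne
  obtain ⟨k, hk⟩ := exists_Oplus_eq_minkRefl hp hvp hv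
  refine ⟨k, by rw [hk, minkRefl_of_orthogonal hvp], ?_⟩
  have hc : 2 * minkB H x (x - y) / minkB H (x - y) (x - y) = 1 := by
    rw [div_eq_one_iff_eq hv]
    simp only [minkB_sub_left, minkB_sub_right, hx.1, hy.1, minkB_comm y x]
    ring
  rw [hk, minkRefl, hc, one_smul, sub_sub_cancel]

theorem exists_ne_zero_orthogonal (hinf : ¬ FiniteDimensional ℝ H) (x y : H) :
    ∃ h : H, h ≠ 0 ∧ ⟪h, x⟫ = 0 ∧ ⟪h, y⟫ = 0 := by
  have hfin : FiniteDimensional ℝ (Submodule.span ℝ {x, y}) :=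
    FiniteDimensional.span_of_finite ℝ (Set.toFinite _)
  have hne : (Submodule.span ℝ {x, y})ᗮ ≠ ⊥ := by
    rw [Ne, Submodule.orthogonal_eq_bot_iff]
    intro htop
    rw [htop] at hfin
    exact hinf (Module.finite_def.2 (Submodule.fg_top _ |>.1 (Module.Finite.fg_top)))
  obtain ⟨h, hmem, h0⟩ := Submodule.exists_mem_ne_zero_of_ne_bot hne
  rw [Submodule.mem_orthogonal'] at hmem
  exact ⟨h, h0, hmem x (Submodule.subset_span (by simp)),
    hmem y (Submodule.subset_span (by simp))⟩

/-- Pointwise continuous one-parameter family in the stabiliser of `p`, starting at the identity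
and moving `q`. -/
theorem exists_stabiliser_path (hinf : ¬ FiniteDimensional ℝ H) {p q : ℝ × H}
    (hp : p ∈ Hyp H) (hq : q ∈ Hyp H) (hqp : q ≠ p) :
    ∃ u : ℝ → Oplus H, @Continuous _ _ _ (ptTop H) u ∧ u 0 = 1 ∧ (∀ t, (u t).1 p = p) ∧
      ∀ t, 0 < t → 1 < minkB H ((u t).1 q) q := by
  set a : ℝ × H := q - minkB H q p • p with ha
  have hap : minkB H a p = 0 := by
    rw [ha, minkB_sub_left, minkB_smul_left, hp.1]
    ring
  have ha0 : a ≠ 0 := by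
    intro h
    have hqs : q = minkB H q p • p := sub_eq_zero.1 h
    have h1 := hq.1
    rw [hqs, minkB_smul_left, minkB_smul_right, hp.1] at h1
    have h2 := one_le_minkB hp hq
    have h3 : minkB H q p = 1 := by nlinarith
    exact hqp (by rw [hqs, h3, one_smul])
  have hA := minkB_self_neg hp hap ha0
  have hqa : minkB H q a = minkB H a a := by
    conv_rhs => rw [ha, ← ha, minkB_sub_left, minkB_smul_left, minkB_comm p a, hap]
    ring
  obtain ⟨h, h0, hhp, hha⟩ := exists_ne_zero_orthogonal hinf p.2 a.2
  set c : ℝ × H := (0, h) with hc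
  have hcp : minkB H c p = 0 := by simp [minkB, hc, hhp]
  have hca : minkB H c a = 0 := by simp [minkB, hc, hha]
  have hC : minkB H c c < 0 := minkB_self_neg hp hcp (by simp [hc, h0])
  have hqc : minkB H q c = 0 := by
    have : q = a + minkB H q p • p := by rw [ha, sub_add_cancel]
    rw [this, minkB_add_left, minkB_smul_left, minkB_comm a, minkB_comm p, hca, hcp]
    ring
  have hbp : ∀ t : ℝ, minkB H (a + t • c) p = 0 := fun t => by
    rw [minkB_add_left, minkB_smul_left, hap, hcp]
    ring
  have hD : ∀ t : ℝ, minkB H (a + t • c) (a + t • c) = minkB H a a + t ^ 2 * minkB H c c :=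
    fun t => by
      simp only [minkB_add_left, minkB_smul_left, minkB_add_right, minkB_smul_right,
        minkB_comm a c, hca]
      ring
  have hDneg : ∀ t : ℝ, minkB H (a + t • c) (a + t • c) < 0 := fun t => by
    rw [hD]
    nlinarith [mul_nonneg (sq_nonneg t) (neg_pos.2 hC).le]
  obtain ⟨r, hr⟩ := exists_Oplus_eq_minkRefl hp hap hA.ne
  choose s hs using fun t => exists_Oplus_eq_minkRefl hp (hbp t) (hDneg t).ne
  have hu : ∀ t w, (r * s t).1 w = minkRefl a (minkRefl (a + t • c) w) := fun t w => by
    rw [← hs, ← hr]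
    rfl
  refine ⟨fun t => r * s t, ?_, ?_, fun t => ?_, fun t ht => ?_⟩
  · refine continuous_induced_rng.2 (continuous_pi fun w => ?_)
    change Continuous fun t => (r * s t).1 w
    simp only [hu]
    refine (continuous_minkRefl a).comp ?_
    unfold minkRefl
    have hb : Continuous fun t : ℝ => a + t • c := by fun_prop
    exact continuous_const.sub
      (((continuous_const.mul (continuous_const.minkB hb)).div (hb.minkB hb)
        fun t => (hDneg t).ne).smul hb)
  · refine Subtype.ext (ContinuousLinearEquiv.ext (funext fun w => ?_))
    rw [hu, zero_smul, add_zero, minkRefl_minkRefl hA.ne]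
    rfl
  · rw [hu, minkRefl_of_orthogonal (hbp t), minkRefl_of_orthogonal hap]
  · have hqq : minkB H (minkRefl a (minkRefl (a + t • c) q)) q =
        minkB H (minkRefl (a + t • c) q) (minkRefl a q) := by
      conv_lhs => rw [← minkRefl_minkRefl hA.ne q]
      rw [minkB_minkRefl hA.ne, minkRefl_minkRefl hA.ne]
    have hDt := hDneg t
    rw [hD] at hDt
    have key : minkB H ((r * s t).1 q) q = 1 + 2 * (minkB H a a * (t ^ 2 * minkB H c c)) /
        -(minkB H a a + t ^ 2 * minkB H c c) := by
      rw [hu, hqq]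
      simp only [minkRefl, hD, minkB_sub_left, minkB_smul_left, minkB_add_left, minkB_add_right,
        minkB_sub_right, minkB_smul_right, hq.1, hqa, hqc, hca, minkB_comm a q, minkB_comm c q]
      have := hA.ne
      have := hDt.ne
      field_simp
      ring
    rw [key]
    have : 0 < minkB H a a * (t ^ 2 * minkB H c c) :=
      mul_pos_of_neg_of_neg hA (mul_neg_of_pos_of_neg (by positivity) hC)
    have : 0 < -(minkB H a a + t ^ 2 * minkB H c c) := by linarith
    simp only [lt_add_iff_pos_right]
    positivity

theorem continuous_Oplus_apply (v : ℝ × H) :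
    @Continuous _ _ (ptTop H) _ fun g : Oplus H => g.1 v :=
  let _ := ptTop H
  (continuous_apply v).comp continuous_induced_dom

end Reflections

/-- for the stabiliser `O` of a point `p₀` of the hyperboloid, `g ∉ O`
and `U` a neighbourhood of the identity in `O`, the set `O g⁻¹ U g O` is a
neighbourhood of `O` in `O₊(B)`. -/
theorem local_structure_neighbourhood
    (H : Type*) [NormedAddCommGroup H] [InnerProductSpace ℝ H] [CompleteSpace H]
    [TopologicalSpace.SeparableSpace H] (hinf : ¬ FiniteDimensional ℝ H)
    (p₀ : ℝ × H) (hp₀ : p₀ ∈ Hyp H)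
    (g : Oplus H) (hg : g.1 p₀ ≠ p₀)
    (U : Set (Oplus H)) (hU : U ⊆ {k : Oplus H | k.1 p₀ = p₀})
    (hUnbhd : ∃ W : Set (Oplus H), @IsOpen _ (ptTop H) W ∧ (1 : Oplus H) ∈ W ∧
      W ∩ {k : Oplus H | k.1 p₀ = p₀} ⊆ U) :
    ∃ V : Set (Oplus H), @IsOpen _ (ptTop H) V ∧ {k : Oplus H | k.1 p₀ = p₀} ⊆ V ∧
      V ⊆ {h : Oplus H | ∃ k₁ ∈ {k : Oplus H | k.1 p₀ = p₀}, ∃ u ∈ U,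
        ∃ k₂ ∈ {k : Oplus H | k.1 p₀ = p₀}, h = k₁ * g⁻¹ * u * g * k₂} := by
  let _ := ptTop H
  obtain ⟨W, hW, h1W, hWU⟩ := hUnbhd
  have hq : g.1 p₀ ∈ Hyp H := (g.2.2 p₀).1 hp₀
  obtain ⟨u, hu, hu0, hup, hut⟩ := exists_stabiliser_path hinf hp₀ hq hg
  have hnhds : u ⁻¹' W ∈ nhds (0 : ℝ) :=
    (hW.preimage hu).mem_nhds (by simpa [hu0] using h1W)
  obtain ⟨ε, hε, hball⟩ := Metric.mem_nhds_iff.1 hnhds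
  set f : ℝ → ℝ := fun t => minkB H ((u t).1 (g.1 p₀)) (g.1 p₀) with hf
  have hfc : Continuous f :=
    ((continuous_Oplus_apply (g.1 p₀)).comp hu).minkB continuous_const
  have hf0 : f 0 = 1 := by
    simp only [hf, hu0]
    exact hq.1
  refine ⟨{h | minkB H (h.1 p₀) p₀ < f (ε / 2)},
    isOpen_lt ((continuous_Oplus_apply p₀).minkB continuous_const) continuous_const, ?_, ?_⟩
  · intro k (hk : k.1 p₀ = p₀)
    change minkB H (k.1 p₀) p₀ < f (ε / 2)
    rw [hk, hp₀.1]
    exact hut _ (half_pos hε)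
  · intro h hh
    have hx : h.1 p₀ ∈ Hyp H := (h.2.2 p₀).1 hp₀
    obtain ⟨t, ⟨ht0, htε⟩, ht⟩ := intermediate_value_Icc (half_pos hε).le hfc.continuousOn
      ⟨hf0.trans_le (one_le_minkB hp₀ hx), le_of_lt hh⟩
    have hy : (g⁻¹ * u t * g).1 p₀ ∈ Hyp H := ((g⁻¹ * u t * g).2.2 p₀).1 hp₀
    have hB : minkB H ((g⁻¹ * u t * g).1 p₀) p₀ = minkB H (h.1 p₀) p₀ := by
      rw [← ht, ← g.2.1]
      congr 1
      exact g.1.apply_symm_apply _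
    obtain ⟨k, hk, hky⟩ := exists_stabiliser_apply_eq hp₀ hy hx hB
    refine ⟨k, hk, u t, hWU ⟨hball ?_, hup t⟩, (k * g⁻¹ * u t * g)⁻¹ * h, ?_, by group⟩
    · rw [Metric.mem_ball, Real.dist_eq, sub_zero, abs_of_nonneg ht0]
      linarith
    · have e : (k * g⁻¹ * u t * g).1 p₀ = h.1 p₀ := hky
      change (k * g⁻¹ * u t * g).1.symm (h.1 p₀) = p₀
      rw [← e, ContinuousLinearEquiv.symm_apply_apply]
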